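/- Let E = ℝ^p and θ₀ ∈ E. Under the parametrized mixture setup with all stated positivity, normalization, differentiability and differentiation-under-the-integral-sign assumptions at θ₀, define the Fisher information matrix of the joint model at θ₀ by F = ∑_o ∫ w θ₀ o · c θ₀ o x · (s o x) (s o x)ᵀ dμ, where s o x ∈ ℝ^p is the gradient at θ₀ of θ ↦ log (w θ o · c θ o x), and assume F is invertible. Then the natural gradients of the ELBO J and of the lower bound J̃ (with auxiliary conditional fixed to the responsibilities at θ₀) coincide at θ₀: F⁻¹ · ∇J(θ₀) = F⁻¹ · ∇J̃(θ₀). (Theorem 1.) -/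

import Mathlib

open MeasureTheory

/-- Differentiation under the integral sign is valid at `θ₀` for `θ ↦ ∫ x, g θ x ∂μ`:
the map is differentiable at `θ₀` with derivative equal to the (Bochner) integral of the
pointwise `θ`-derivative of the integrand, the latter being integrable. -/
def DiffUnderIntegral {E : Type*} [NormedAddCommGroup E] [NormedSpace ℝ E]
    {X : Type*} [MeasurableSpace X] (μ : Measure X) (g : E → X → ℝ) (θ₀ : E) : Prop :=
  ∃ D : X → (E →L[ℝ] ℝ), Integrable D μ ∧
    (∀ᵐ x ∂μ, HasFDerivAt (fun θ => g θ x) (D x) θ₀) ∧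
    HasFDerivAt (fun θ => ∫ x, g θ x ∂μ) (∫ x, D x ∂μ) θ₀

/-- Gibbs' inequality for unnormalized weights `a` against a probability vector `t`. -/
lemma sum_mul_log_sub_log_le {O : Type*} [Fintype O] [Nonempty O] {a t : O → ℝ}
    (ha : ∀ o, 0 < a o) (ht : ∀ o, 0 < t o) (hsum : ∑ o, t o = 1) :
    ∑ o, a o * (Real.log (t o) - Real.log (a o)) ≤ -((∑ o, a o) * Real.log (∑ o, a o)) := by
  set A := ∑ o, a o with hA
  have hApos : 0 < A := Finset.sum_pos (fun o _ => ha o) Finset.univ_nonempty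
  have hterm : ∀ o, a o * (Real.log (t o) - Real.log (a o)) ≤ t o * A - a o - a o * Real.log A := by
    intro o
    have hlog := Real.log_le_sub_one_of_pos (div_pos (mul_pos (ht o) hApos) (ha o))
    rw [Real.log_div (mul_pos (ht o) hApos).ne' (ha o).ne',
      Real.log_mul (ht o).ne' hApos.ne'] at hlog
    have hmul := mul_le_mul_of_nonneg_left hlog (ha o).le
    have hcancel : a o * (t o * A / a o - 1) = t o * A - a o := by
      have := (ha o).ne'
      field_simp
    rw [hcancel] at hmul
    linarith
  calc _ ≤ ∑ o, (t o * A - a o - a o * Real.log A) := Finset.sum_le_sum fun o _ => hterm o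
    _ = -(A * Real.log A) := by
      rw [Finset.sum_sub_distrib, Finset.sum_sub_distrib, ← Finset.sum_mul, ← Finset.sum_mul,
        hsum, ← hA]
      ring

/-- The case of equality in Gibbs' inequality: `t` is the normalization of `a`. -/
lemma sum_mul_log_sub_log_eq {O : Type*} [Fintype O] [Nonempty O] {a t : O → ℝ}
    (ha : ∀ o, 0 < a o) (ht : ∀ o, t o = a o / ∑ o, a o) :
    ∑ o, a o * (Real.log (t o) - Real.log (a o)) = -((∑ o, a o) * Real.log (∑ o, a o)) := by
  have hApos : 0 < ∑ o, a o := Finset.sum_pos (fun o _ => ha o) Finset.univ_nonempty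
  rw [Finset.sum_mul, ← Finset.sum_neg_distrib]
  refine Finset.sum_congr rfl fun o _ => ?_
  rw [ht, Real.log_div (ha o).ne' hApos.ne']
  ring

/-- The lower bound as a single integral. -/
lemma lowerBound_eq_integral {X : Type*} [MeasurableSpace X] {μ : Measure X}
    {O : Type*} [Fintype O] {w : O → ℝ} {c τ : O → X → ℝ} {ρ : X → ℝ}
    (hw : ∀ o, 0 < w o) (hc : ∀ o x, 0 < c o x) (hc1 : ∀ o, ∫ x, c o x ∂μ = 1)
    (hint : ∀ o, Integrable
      (fun x => c o x * (ρ x + Real.log (τ o x) - Real.log (c o x))) μ) :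
    Integrable (fun x => (∑ o, w o * (c o x * ρ x)) +
        ∑ o, w o * c o x * (Real.log (τ o x) - Real.log (w o * c o x))) μ ∧
      ∑ o, w o * ((∫ x, c o x * (ρ x + Real.log (τ o x) - Real.log (c o x)) ∂μ) -
        Real.log (w o)) =
      ∫ x, ((∑ o, w o * (c o x * ρ x)) +
        ∑ o, w o * c o x * (Real.log (τ o x) - Real.log (w o * c o x))) ∂μ := by
  have hcint : ∀ o, Integrable (c o) μ := fun o =>
    .of_integral_ne_zero (by rw [hc1]; exact one_ne_zero)
  have hcongr : (fun x => (∑ o, w o * (c o x * ρ x)) +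
      ∑ o, w o * c o x * (Real.log (τ o x) - Real.log (w o * c o x))) =
      fun x => ∑ o, w o * (c o x * (ρ x + Real.log (τ o x) - Real.log (c o x)) -
        c o x * Real.log (w o)) := by
    funext x
    rw [← Finset.sum_add_distrib]
    refine Finset.sum_congr rfl fun o _ => ?_
    rw [Real.log_mul (hw o).ne' (hc o x).ne']
    ring
  have hterm : ∀ o, Integrable (fun x =>
      w o * (c o x * (ρ x + Real.log (τ o x) - Real.log (c o x)) - c o x * Real.log (w o))) μ :=
    fun o => ((hint o).sub ((hcint o).mul_const _)).const_mul _
  rw [hcongr]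
  refine ⟨integrable_finsetSum _ fun o _ => hterm o, ?_⟩
  rw [integral_finsetSum _ fun o _ => hterm o]
  refine Finset.sum_congr rfl fun o _ => ?_
  rw [integral_const_mul, integral_sub (hint o) ((hcint o).mul_const _), integral_mul_const,
    hc1, one_mul]

/-- The ELBO as a single integral. -/
lemma elbo_eq_integral {X : Type*} [MeasurableSpace X] {μ : Measure X}
    {O : Type*} [Fintype O] {w : O → ℝ} {c : O → X → ℝ} {ρ h : X → ℝ}
    (hint : ∀ o, Integrable (fun x => c o x * ρ x) μ) (hh : Integrable h μ) :
    Integrable (fun x => (∑ o, w o * (c o x * ρ x)) + -h x) μ ∧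
      (∑ o, w o * ∫ x, c o x * ρ x ∂μ) - ∫ x, h x ∂μ =
        ∫ x, ((∑ o, w o * (c o x * ρ x)) + -h x) ∂μ := by
  have hsum : Integrable (fun x => ∑ o, w o * (c o x * ρ x)) μ :=
    integrable_finsetSum _ fun o _ => (hint o).const_mul _
  refine ⟨hsum.add hh.neg, ?_⟩
  simp only [← sub_eq_add_neg]
  rw [integral_sub hsum hh, integral_finsetSum _ fun o _ => (hint o).const_mul _]
  simp only [integral_const_mul]

/-- Two functions differentiable at a point have the same gradient there if one lies below the
other near the point and they agree at it. -/
lemma gradient_eq_of_eventually_le {E : Type*} [NormedAddCommGroup E] [InnerProductSpace ℝ E]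
    [CompleteSpace E] {f g : E → ℝ} {a : E} (hf : DifferentiableAt ℝ f a)
    (hg : DifferentiableAt ℝ g a) (hle : ∀ᶠ x in nhds a, g x ≤ f x) (heq : g a = f a) :
    gradient f a = gradient g a := by
  have hmin : IsLocalMin (f - g) a := by
    filter_upwards [hle] with x hx
    simp only [Pi.sub_apply]
    linarith
  have hzero := hmin.fderiv_eq_zero
  rw [fderiv_sub hf hg, sub_eq_zero] at hzero
  rw [gradient, gradient, hzero]

/-- Theorem 1 (natural gradient form): with the Fisher information matrix `F` of the joint
model at `θ₀` invertible, the natural gradients of the ELBO `J` and of the lower bound `J̃`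
(with auxiliary conditional fixed to the responsibilities at `θ₀`) coincide at `θ₀`. -/
theorem naturalGradient_elbo_eq_naturalGradient_lowerBound
    {X : Type*} [MeasurableSpace X] (μ : Measure X)
    {O : Type*} [Fintype O] [Nonempty O]
    {p : ℕ} (θ₀ : EuclideanSpace ℝ (Fin p))
    (w : EuclideanSpace ℝ (Fin p) → O → ℝ)
    (c : EuclideanSpace ℝ (Fin p) → O → X → ℝ) (ρ : X → ℝ)
    (q : EuclideanSpace ℝ (Fin p) → X → ℝ) (hq : ∀ θ x, q θ x = ∑ o, w θ o * c θ o x)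
    (hρ : Measurable ρ)
    -- positivity, normalization and measurability for θ in a neighborhood of θ₀
    (hsetup : ∀ᶠ θ in nhds θ₀,
      (∀ o, 0 < w θ o) ∧ (∑ o, w θ o = 1) ∧
      (∀ o, Measurable (c θ o)) ∧ (∀ o x, 0 < c θ o x) ∧
      (∀ o, ∫ x, c θ o x ∂μ = 1))
    -- pointwise differentiability at θ₀
    (hwdiff : ∀ o, DifferentiableAt ℝ (fun θ => w θ o) θ₀)
    (hcdiff : ∀ o x, DifferentiableAt ℝ (fun θ => c θ o x) θ₀)
    -- the auxiliary conditional: responsibilities of the model at θ₀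
    (τ : O → X → ℝ) (hτ : ∀ o x, τ o x = w θ₀ o * c θ₀ o x / q θ₀ x)
    -- the ELBO J and the lower bound J̃
    (J Jt : EuclideanSpace ℝ (Fin p) → ℝ)
    (hJ : ∀ θ, J θ =
      (∑ o, w θ o * ∫ x, c θ o x * ρ x ∂μ) - ∫ x, q θ x * Real.log (q θ x) ∂μ)
    (hJt : ∀ θ, Jt θ = ∑ o, w θ o *
      ((∫ x, c θ o x * (ρ x + Real.log (τ o x) - Real.log (c θ o x)) ∂μ) -
        Real.log (w θ o)))
    -- all integrals appearing exist (for θ in a neighborhood of θ₀)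
    (hint1 : ∀ᶠ θ in nhds θ₀, ∀ o, Integrable (fun x => c θ o x * ρ x) μ)
    (hint2 : ∀ᶠ θ in nhds θ₀, Integrable (fun x => q θ x * Real.log (q θ x)) μ)
    (hint3 : ∀ᶠ θ in nhds θ₀, ∀ o,
      Integrable (fun x => c θ o x * (ρ x + Real.log (τ o x) - Real.log (c θ o x))) μ)
    -- differentiation under the integral sign is valid at θ₀ for each integral term
    (hdui1 : ∀ o, DiffUnderIntegral μ (fun θ x => c θ o x * ρ x) θ₀)
    (hdui2 : DiffUnderIntegral μ (fun θ x => q θ x * Real.log (q θ x)) θ₀)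
    (hdui3 : ∀ o, DiffUnderIntegral μ
      (fun θ x => c θ o x * (ρ x + Real.log (τ o x) - Real.log (c θ o x))) θ₀)
    -- the score of the joint model: s o x is the gradient at θ₀ of θ ↦ log (w θ o · c θ o x)
    (s : O → X → EuclideanSpace ℝ (Fin p))
    (hs : ∀ o x, HasGradientAt (fun θ => Real.log (w θ o * c θ o x)) (s o x) θ₀)
    -- the Fisher information matrix of the joint model at θ₀
    (F : Matrix (Fin p) (Fin p) ℝ)
    (hFint : ∀ o i j, Integrable (fun x => w θ₀ o * c θ₀ o x * (s o x i * s o x j)) μ)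
    (hF : ∀ i j, F i j = ∑ o, ∫ x, w θ₀ o * c θ₀ o x * (s o x i * s o x j) ∂μ)
    (hFinv : IsUnit F.det) :
    F⁻¹.mulVec (fun i => gradient J θ₀ i) = F⁻¹.mulVec (fun i => gradient Jt θ₀ i) := by
  obtain ⟨hw₀, -, -, hc₀, hc1₀⟩ := hsetup.self_of_nhds
  have ha₀ : ∀ x o, 0 < w θ₀ o * c θ₀ o x := fun x o => mul_pos (hw₀ o) (hc₀ o x)
  have hqpos : ∀ x, 0 < q θ₀ x := fun x => by
    rw [hq]; exact Finset.sum_pos (fun o _ => ha₀ x o) Finset.univ_nonempty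
  have hτpos : ∀ x o, 0 < τ o x := fun x o => by
    rw [hτ]; exact div_pos (ha₀ x o) (hqpos x)
  have hτsum : ∀ x, ∑ o, τ o x = 1 := fun x => by
    simp only [hτ]
    rw [← Finset.sum_div, ← hq, div_self (hqpos x).ne']
  have hJdiff : DifferentiableAt ℝ J θ₀ := by
    rw [funext hJ]
    obtain ⟨_, -, -, hD⟩ := hdui2
    refine .sub (.fun_sum fun o _ => (hwdiff o).mul ?_) hD.differentiableAt
    obtain ⟨_, -, -, hD'⟩ := hdui1 o
    exact hD'.differentiableAt
  have hJtdiff : DifferentiableAt ℝ Jt θ₀ := by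
    rw [funext hJt]
    refine .fun_sum fun o _ => (hwdiff o).mul (.sub ?_ ((hwdiff o).log (hw₀ o).ne'))
    obtain ⟨_, -, -, hD⟩ := hdui3 o
    exact hD.differentiableAt
  have hle : ∀ᶠ θ in nhds θ₀, Jt θ ≤ J θ := by
    filter_upwards [hsetup, hint1, hint2, hint3] with θ ⟨hw, _, _, hc, hc1⟩ h1 h2 h3
    obtain ⟨hJtint, hJteq⟩ := lowerBound_eq_integral hw hc hc1 h3
    obtain ⟨hJint, hJeq⟩ := elbo_eq_integral (w := w θ) h1 h2
    rw [hJ, hJt, hJteq, hJeq]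
    refine integral_mono hJtint hJint fun x => ?_
    simp only [hq]
    gcongr
    exact sum_mul_log_sub_log_le (fun o => mul_pos (hw o) (hc o x)) (hτpos x) (hτsum x)
  have heq : Jt θ₀ = J θ₀ := by
    rw [hJ, hJt, (lowerBound_eq_integral hw₀ hc₀ hc1₀ hint3.self_of_nhds).2,
      (elbo_eq_integral (w := w θ₀) hint1.self_of_nhds hint2.self_of_nhds).2]
    congr 1 with x
    rw [sum_mul_log_sub_log_eq (ha₀ x) fun o => by rw [hτ, hq], hq]
  rw [gradient_eq_of_eventually_le hJdiff hJtdiff hle heq]
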